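/- For all real y₁ > 0 and y₂ > 0, the dilogarithm identity of type B₂ holds: 2·L̃(y₂(1+y₁)) + L̃(y₁) = L̃( y₁ / (1+y₂+y₁y₂)² ) + 2·L̃( y₁y₂ / ((1+y₂)² + y₁y₂²) ) + L̃( y₁y₂² / (1+y₂)² ) + 2·L̃(y₂). -/

import Mathlib

/-- The modified Rogers dilogarithm
`L̃(x) = ∫₀ˣ log(1+t)/t dt − (1/2) log x · log(1+x)` (for `x > 0`). -/
noncomputable def Ltilde (x : ℝ) : ℝ :=
  (∫ t in (0 : ℝ)..x, Real.log (1 + t) / t) - (1 / 2) * Real.log x * Real.log (1 + x)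

open MeasureTheory Set Filter Topology in
theorem Lt_integrable (M : ℝ) (hM : 0 ≤ M) :
    IntervalIntegrable (fun t : ℝ => Real.log (1 + t) / t) volume 0 M := by
  rw [intervalIntegrable_iff_integrableOn_Ioc_of_le hM]
  refine Measure.integrableOn_of_bounded (M := 1) (by simp) ?_ ?_
  · exact (by fun_prop : Measurable (fun t : ℝ => Real.log (1 + t) / t)).aestronglyMeasurable
  · refine (ae_restrict_iff' measurableSet_Ioc).2 (Eventually.of_forall fun t ht => ?_)
    have h1 : 0 < t := ht.1
    have h2 : 0 ≤ Real.log (1 + t) := Real.log_nonneg (by linarith)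
    have h3 := Real.log_le_sub_one_of_pos (by linarith : 0 < 1 + t)
    rw [Real.norm_of_nonneg (by positivity), div_le_one h1]
    linarith

open MeasureTheory Set Filter Topology in
theorem Lt_hasDerivAt (x : ℝ) (hx : 0 < x) :
    HasDerivAt Ltilde (1 / 2 * (Real.log (1 + x) / x - Real.log x / (1 + x))) x := by
  have h1 : HasDerivAt (fun x : ℝ => ∫ t in (0 : ℝ)..x, Real.log (1 + t) / t)
      (Real.log (1 + x) / x) x := by
    refine intervalIntegral.integral_hasDerivAt_right (Lt_integrable x hx.le) ?_ ?_
    · exact (by fun_prop : Measurable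
        (fun t : ℝ => Real.log (1 + t) / t)).stronglyMeasurable.stronglyMeasurableAtFilter
    · have : 1 + x ≠ 0 := by positivity
      exact ((continuousAt_const.add continuousAt_id).log this).div continuousAt_id hx.ne'
  have h2 := Real.hasDerivAt_log hx.ne'
  have h3 : HasDerivAt (fun x : ℝ => Real.log (1 + x)) (1 / (1 + x)) x :=
    ((hasDerivAt_id x).const_add 1).log (by simp; positivity)
  have h4 := h1.sub ((h2.const_mul (1 / 2)).mul h3)
  refine HasDerivAt.congr_deriv (f := Ltilde) h4 ?_
  field_simp
  ring

open MeasureTheory Set Filter Topology in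
theorem Lt_cont : ContinuousOn Ltilde (Ici 0) := by
  intro x hx
  rcases (mem_Ici.1 hx).eq_or_lt with h | h
  · subst h
    have e : Ltilde 0 = 0 := by simp [Ltilde]
    have hb : Tendsto (fun x : ℝ => x + 1 / 2 * |x * Real.log x|) (𝓝[≥] 0) (𝓝 0) := by
      have : Continuous (fun x : ℝ => x + 1 / 2 * |x * Real.log x|) :=
        continuous_id.add (continuous_const.mul Real.continuous_mul_log.abs)
      have h := this.tendsto 0
      simp only [zero_mul, abs_zero, mul_zero, add_zero] at h
      exact h.mono_left nhdsWithin_le_nhds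
    rw [ContinuousWithinAt, e]
    refine squeeze_zero_norm' ?_ hb
    filter_upwards [self_mem_nhdsWithin] with x hx
    have hx : 0 ≤ x := hx
    have h2 : 0 ≤ Real.log (1 + x) := Real.log_nonneg (by linarith)
    have h3 := Real.log_le_sub_one_of_pos (by linarith : 0 < 1 + x)
    unfold Ltilde
    refine (norm_sub_le _ _).trans (add_le_add ?_ ?_)
    · have := intervalIntegral.norm_integral_le_of_norm_le_const (a := 0) (b := x) (C := 1)
        (f := fun t : ℝ => Real.log (1 + t) / t) ?_
      · simpa [abs_of_nonneg hx] using this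
      · intro t ht
        rw [uIoc_of_le hx] at ht
        have h1 : 0 < t := ht.1
        have h2 : 0 ≤ Real.log (1 + t) := Real.log_nonneg (by linarith)
        have h3 := Real.log_le_sub_one_of_pos (by linarith : 0 < 1 + t)
        rw [Real.norm_of_nonneg (by positivity), div_le_one h1]
        linarith
    · rw [Real.norm_eq_abs, mul_assoc, abs_mul, abs_mul, abs_mul, abs_of_nonneg h2,
        abs_of_nonneg hx, abs_of_pos (by norm_num : (0 : ℝ) < 1 / 2)]
      have := mul_le_mul_of_nonneg_left (by linarith : Real.log (1 + x) ≤ x)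
        (abs_nonneg (Real.log x))
      linarith
  · exact (Lt_hasDerivAt x h).continuousAt.continuousWithinAt

theorem Lt_comp (f : ℝ → ℝ) (a f' p q r s : ℝ) (hf : HasDerivAt f f' a) (h0 : 0 < f a)
    (hp : Real.log (f a) = p) (hq : Real.log (1 + f a) = q) (hr : f' / f a = r)
    (hs : f' / (1 + f a) = s) :
    HasDerivAt (fun x => Ltilde (f x)) (1 / 2 * (r * q - s * p)) a := by
  refine ((Lt_hasDerivAt _ h0).comp a hf).congr_deriv ?_
  rw [hp, hq, ← hr, ← hs]
  ring

theorem Lt_main_deriv (b : ℝ) (hb : 0 < b) (a : ℝ) (ha : 0 < a) :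
    HasDerivAt (fun a => 2 * Ltilde (b * (1 + a)) + Ltilde a
      - (Ltilde (a / (1 + b + a * b) ^ 2)
        + 2 * Ltilde (a * b / ((1 + b) ^ 2 + a * b ^ 2))
        + Ltilde (a * b ^ 2 / (1 + b) ^ 2))) 0 a := by
  have hP : 0 < 1 + b + a * b := by positivity
  have hQ : 0 < (1 + b) ^ 2 + a * b ^ 2 := by positivity
  have hA : 0 < 1 + a := by positivity
  have hB : 0 < 1 + b := by positivity
  have hdA : HasDerivAt (fun a : ℝ => 1 + a) 1 a := (hasDerivAt_id a).const_add 1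
  have hdP : HasDerivAt (fun a : ℝ => 1 + b + a * b) b a := by
    simpa using ((hasDerivAt_id a).mul_const b).const_add (1 + b)
  have hdQ : HasDerivAt (fun a : ℝ => (1 + b) ^ 2 + a * b ^ 2) (b ^ 2) a := by
    simpa using ((hasDerivAt_id a).mul_const (b ^ 2)).const_add ((1 + b) ^ 2)
  have e3 : 1 + a / (1 + b + a * b) ^ 2
      = (1 + a) * ((1 + b) ^ 2 + a * b ^ 2) / (1 + b + a * b) ^ 2 := by
    field_simp; ring
  have e4 : 1 + a * b / ((1 + b) ^ 2 + a * b ^ 2)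
      = (1 + b) * (1 + b + a * b) / ((1 + b) ^ 2 + a * b ^ 2) := by
    field_simp; ring
  have e5 : 1 + a * b ^ 2 / (1 + b) ^ 2 = ((1 + b) ^ 2 + a * b ^ 2) / (1 + b) ^ 2 := by
    field_simp
  have d1 := Lt_comp (fun a => b * (1 + a)) a _ (Real.log b + Real.log (1 + a))
    (Real.log (1 + b + a * b)) (1 / (1 + a)) (b / (1 + b + a * b))
    (hdA.const_mul b) (by positivity) (Real.log_mul hb.ne' hA.ne') (by congr 1; ring)
    (by field_simp) (by congr 1 <;> ring)
  have d2 := Lt_comp (fun a => a) a _ (Real.log a) (Real.log (1 + a)) (1 / a) (1 / (1 + a))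
    (hasDerivAt_id a) ha rfl rfl rfl rfl
  have d3 := Lt_comp (fun a => a / (1 + b + a * b) ^ 2) a _
    (Real.log a - 2 * Real.log (1 + b + a * b))
    (Real.log (1 + a) + Real.log ((1 + b) ^ 2 + a * b ^ 2) - 2 * Real.log (1 + b + a * b))
    (1 / a - 2 * (b / (1 + b + a * b)))
    (1 / (1 + a) + b ^ 2 / ((1 + b) ^ 2 + a * b ^ 2) - 2 * (b / (1 + b + a * b)))
    ((hasDerivAt_id a).div (hdP.pow 2) (pow_pos hP 2).ne') (by positivity)
    (by rw [Real.log_div ha.ne' (by positivity), Real.log_pow]; norm_num)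
    (by rw [e3, Real.log_div (by positivity) (by positivity), Real.log_mul hA.ne' hQ.ne',
          Real.log_pow]; norm_num)
    (by simp; field_simp) (by rw [e3]; simp; field_simp; ring)
  have d4 := Lt_comp (fun a => a * b / ((1 + b) ^ 2 + a * b ^ 2)) a _
    (Real.log a + Real.log b - Real.log ((1 + b) ^ 2 + a * b ^ 2))
    (Real.log (1 + b) + Real.log (1 + b + a * b) - Real.log ((1 + b) ^ 2 + a * b ^ 2))
    (1 / a - b ^ 2 / ((1 + b) ^ 2 + a * b ^ 2))
    (b / (1 + b + a * b) - b ^ 2 / ((1 + b) ^ 2 + a * b ^ 2))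
    (((hasDerivAt_id a).mul_const b).div hdQ hQ.ne') (by positivity)
    (by rw [Real.log_div (by positivity) hQ.ne', Real.log_mul ha.ne' hb.ne'])
    (by rw [e4, Real.log_div (by positivity) hQ.ne', Real.log_mul hB.ne' hP.ne'])
    (by simp; field_simp) (by rw [e4]; simp; field_simp; ring)
  have d5 := Lt_comp (fun a => a * b ^ 2 / (1 + b) ^ 2) a _
    (Real.log a + 2 * Real.log b - 2 * Real.log (1 + b))
    (Real.log ((1 + b) ^ 2 + a * b ^ 2) - 2 * Real.log (1 + b))
    (1 / a) (b ^ 2 / ((1 + b) ^ 2 + a * b ^ 2))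
    (((hasDerivAt_id a).mul_const (b ^ 2)).div_const ((1 + b) ^ 2)) (by positivity)
    (by rw [Real.log_div (by positivity) (by positivity), Real.log_mul ha.ne' (by positivity),
          Real.log_pow, Real.log_pow]; norm_num)
    (by rw [e5, Real.log_div hQ.ne' (by positivity), Real.log_pow]; norm_num)
    (by field_simp) (by rw [e5]; field_simp)
  refine (((d1.const_mul 2).add d2).sub ((d3.add (d4.const_mul 2)).add d5)).congr_deriv ?_
  ring

/-- The dilogarithm identity of type B₂ (Example 4.2 of the paper). -/
theorem B2_dilogarithm_identity (y₁ y₂ : ℝ) (hy₁ : 0 < y₁) (hy₂ : 0 < y₂) :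
    2 * Ltilde (y₂ * (1 + y₁)) + Ltilde y₁
      = Ltilde (y₁ / (1 + y₂ + y₁ * y₂) ^ 2)
        + 2 * Ltilde (y₁ * y₂ / ((1 + y₂) ^ 2 + y₁ * y₂ ^ 2))
        + Ltilde (y₁ * y₂ ^ 2 / (1 + y₂) ^ 2)
        + 2 * Ltilde y₂ := by
  have key : ∀ f : ℝ → ℝ, ContinuousOn f (Set.Icc 0 y₁) → (∀ a ∈ Set.Icc 0 y₁, 0 ≤ f a) →
      ContinuousOn (fun a => Ltilde (f a)) (Set.Icc 0 y₁) :=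
    fun f hf h => Lt_cont.comp hf h
  have hc : ContinuousOn (fun a => 2 * Ltilde (y₂ * (1 + a)) + Ltilde a
      - (Ltilde (a / (1 + y₂ + a * y₂) ^ 2)
        + 2 * Ltilde (a * y₂ / ((1 + y₂) ^ 2 + a * y₂ ^ 2))
        + Ltilde (a * y₂ ^ 2 / (1 + y₂) ^ 2))) (Set.Icc 0 y₁) := by
    have k1 := key (fun a => y₂ * (1 + a)) (by fun_prop)
      (fun a ha => by have := ha.1; positivity)
    have k2 := key (fun a => a) (by fun_prop) (fun a ha => ha.1)
    have k3 := key (fun a => a / (1 + y₂ + a * y₂) ^ 2)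
      (ContinuousOn.div (by fun_prop) (by fun_prop) (fun a ha => by have := ha.1; positivity))
      (fun a ha => by have := ha.1; positivity)
    have k4 := key (fun a => a * y₂ / ((1 + y₂) ^ 2 + a * y₂ ^ 2))
      (ContinuousOn.div (by fun_prop) (by fun_prop) (fun a ha => by have := ha.1; positivity))
      (fun a ha => by have := ha.1; positivity)
    have k5 := key (fun a => a * y₂ ^ 2 / (1 + y₂) ^ 2)
      (ContinuousOn.div (by fun_prop) (by fun_prop) (fun a ha => by have := ha.1; positivity))
      (fun a ha => by have := ha.1; positivity)
    exact ((continuousOn_const.mul k1).add k2).sub ((k3.add (continuousOn_const.mul k4)).add k5)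
  obtain ⟨c, -, h⟩ := exists_hasDerivAt_eq_slope _ (fun _ => 0) hy₁ hc
    (fun a ha => Lt_main_deriv y₂ hy₂ a ha.1)
  have e : Ltilde 0 = 0 := by simp [Ltilde]
  rw [eq_div_iff (by linarith)] at h
  simp only [zero_mul, zero_div, add_zero, mul_one, e, mul_zero] at h
  linarith
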